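/- arXiv:1706.04569 — 2 statements merged into one kernel-verified Lean document; each statement's English description precedes it below -/
import Mathlib

section
/- Suppose d > 0, n ∈ [2,3], and c ∈ [1.55, n). Then g₃(Q_*) < 0, so that F₃(Q_*, μ) = g₃(Q_*) < 0 for every μ ∈ ℝ; moreover μ₃(Q) → +∞ as Q → Q_*⁺. -/
open Set Filter Topology intervalIntegral Real

noncomputable section

/-- The rescaled traveling-wave ODE for the magma equation at a point `r`. -/
def magmaODE (d n c : ℝ) (Q : ℝ → ℝ) (r : ℝ) : Prop :=
  -deriv Q r + (1 / c) * deriv (fun s => Q s ^ n) r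
    + deriv (fun s => Q s ^ n * deriv (deriv Q) s) r
    + (d - 1) * Q r ^ n * deriv (fun s => deriv Q s / s) r = 0

/-- Solution of the IVP on `[0, σ]`. -/
def isIVPSolutionOn (d n c μ : ℝ) (Q : ℝ → ℝ) (σ : ℝ) : Prop :=
  ContDiffOn ℝ 3 Q (Icc 0 σ) ∧ (∀ r ∈ Ioo (0:ℝ) σ, magmaODE d n c Q r) ∧
    Q 0 = 1 ∧ deriv Q 0 = 0 ∧ deriv (deriv Q) 0 = μ

/-- Solution of the IVP on `[0, ∞)`. -/
def isIVPSolution (d n c μ : ℝ) (Q : ℝ → ℝ) : Prop :=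
  ContDiffOn ℝ 3 Q (Ici 0) ∧ (∀ r : ℝ, 0 < r → magmaODE d n c Q r) ∧
    Q 0 = 1 ∧ deriv Q 0 = 0 ∧ deriv (deriv Q) 0 = μ

def F1 (d n c : ℝ) (Q μ : ℝ) : ℝ :=
  -(1 / (n - 1)) * (Q ^ (1 - n) - 1) - (n / c) * Real.log Q + μ * d

def F2 (d n c : ℝ) (Q μ : ℝ) : ℝ :=
  ∫ q in (1:ℝ)..Q, F1 d n c q μ * q ^ n

def F3 (d n c : ℝ) (Q μ : ℝ) : ℝ :=
  F1 d n c Q μ - n * ∫ q in (1:ℝ)..Q, F2 d n c q μ * q ^ (-(n + 2))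

def mu1 (d n c Q : ℝ) : ℝ := -(F1 d n c Q 0) / (F1 d n c Q 1 - F1 d n c Q 0)
def mu2 (d n c Q : ℝ) : ℝ := -(F2 d n c Q 0) / (F2 d n c Q 1 - F2 d n c Q 0)
def mu3 (d n c Q : ℝ) : ℝ := -(F3 d n c Q 0) / (F3 d n c Q 1 - F3 d n c Q 0)

def h3ex (d n Q : ℝ) : ℝ :=
  d * (1 - n * Real.log Q / (n + 1) - n / (n + 1) ^ 2 * (Q ^ (-(n + 1)) - 1))

def setA (d n c Qs : ℝ) : Set ℝ :=
  {μ : ℝ | μ < 0 ∧ ∃ (Q : ℝ → ℝ) (σ rs : ℝ), 0 < rs ∧ rs < σ ∧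
    isIVPSolutionOn d n c μ Q σ ∧ (∀ r ∈ Ioc (0:ℝ) σ, 0 < Q r ∧ deriv Q r < 0) ∧
    Q rs = Qs}

theorem exp_sub_self_lt_exp_sub_self {a b : ℝ} (ha : 0 ≤ a) (hab : a < b) :
    Real.exp a - a < Real.exp b - b := by
  have h1 : Real.exp b = Real.exp a * Real.exp (b - a) := by
    rw [← Real.exp_add]; congr 1; ring
  have h2 := Real.add_one_lt_exp (sub_ne_zero.mpr hab.ne')
  have h3 := Real.one_le_exp ha
  nlinarith

theorem exp_seed_le {u : ℝ} (hu0 : 0 ≤ u) (hu1 : u ≤ 1) :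
    Real.exp (2.012 + 0.12 * u) ≤ 5 + u + 1 / (2 + u) + (2.012 + 0.12 * u) := by
  have e1 : Real.exp 2.012 ≤ 7.4785 := by
    have h : Real.exp 2.012 = Real.exp 0.503 ^ 4 := by
      rw [← Real.exp_nat_mul]; norm_num
    have h' := Real.exp_bound' (x := 0.503) (by norm_num) (by norm_num) (n := 7) (by norm_num)
    have h'' : Real.exp 0.503 ≤ 1.65368 := by
      refine h'.trans ?_
      norm_num [Finset.sum_range_succ, Nat.factorial]
    rw [h]
    exact (pow_le_pow_left₀ (Real.exp_pos _).le h'' 4).trans (by norm_num)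
  have e2 : Real.exp 2.132 ≤ 8.432 := by
    have h : Real.exp 2.132 = Real.exp 0.533 ^ 4 := by
      rw [← Real.exp_nat_mul]; norm_num
    have h' := Real.exp_bound' (x := 0.533) (by norm_num) (by norm_num) (n := 7) (by norm_num)
    have h'' : Real.exp 0.533 ≤ 1.70404 := by
      refine h'.trans ?_
      norm_num [Finset.sum_range_succ, Nat.factorial]
    rw [h]
    exact (pow_le_pow_left₀ (Real.exp_pos _).le h'' 4).trans (by norm_num)
  have hconv := convexOn_exp.2 (mem_univ (2.012 : ℝ)) (mem_univ (2.132 : ℝ))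
    (sub_nonneg.mpr hu1) hu0 (by ring)
  simp only [smul_eq_mul] at hconv
  rw [show (1 - u) * 2.012 + u * 2.132 = 2.012 + 0.12 * u by ring] at hconv
  have hupper : Real.exp (2.012 + 0.12 * u) ≤ (1 - u) * 7.4785 + u * 8.432 := by
    nlinarith
  refine hupper.trans ?_
  have : (1 - u) * 7.4785 + u * 8.432 - (5 + u) - (2.012 + 0.12 * u) ≤ 1 / (2 + u) := by
    rw [le_div_iff₀ (by linarith)]
    nlinarith [sq_nonneg (u - 1 / 2)]
  linarith

theorem le_exp_seed {u : ℝ} (hu0 : 0 ≤ u) (hu1 : u ≤ 1) :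
    1.95 + 0.95 * u ≤ Real.exp ((1 + u) * ((2.012 + 0.12 * u) / (3 + u))) := by
  have hpos : (0 : ℝ) < 3 + u := by linarith
  set z := (1 + u) * ((2.012 + 0.12 * u) / (3 + u)) - 0.87 with hz
  have hzu : z = (0.12 * u ^ 2 + 1.262 * u - 0.598) / (3 + u) := by
    rw [hz]; field_simp; ring
  have hz1 : z ≤ 0.2 := by
    rw [hzu, div_le_iff₀ hpos]; nlinarith
  have hz0 : -0.2 ≤ z := by
    rw [hzu, le_div_iff₀ hpos]; nlinarith
  have habs : |z| ≤ 0.2 := abs_le.mpr ⟨hz0, hz1⟩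
  have hb := Real.exp_bound (habs.trans (by norm_num)) (n := 4) (by norm_num)
  have hp4 : |z| ^ 4 ≤ 0.2 ^ 4 := pow_le_pow_left₀ (abs_nonneg z) habs 4
  norm_num [Finset.sum_range_succ, Nat.factorial] at hb
  have hb' := (abs_le.mp hb).1
  have hcubic : 1 + z + z ^ 2 / 2 + z ^ 3 / 6 - 0.0001 ≤ Real.exp z := by
    linarith
  have hbase : 2.3869 ≤ Real.exp 0.87 := by
    refine le_trans ?_ (Real.sum_le_exp_of_nonneg (by norm_num) 10)
    norm_num [Finset.sum_range_succ, Nat.factorial]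
  have hsplit : Real.exp ((1 + u) * ((2.012 + 0.12 * u) / (3 + u)))
      = Real.exp 0.87 * Real.exp z := by
    rw [← Real.exp_add]; congr 1; rw [hz]; ring
  rw [hsplit]
  have hprod : 2.3869 * (1 + z + z ^ 2 / 2 + z ^ 3 / 6 - 0.0001)
      ≤ Real.exp 0.87 * Real.exp z :=
    (mul_le_mul_of_nonneg_left hcubic (by norm_num)).trans
      (mul_le_mul_of_nonneg_right hbase (Real.exp_pos z).le)
  refine le_trans ?_ hprod
  rw [hzu, ← sub_nonneg]
  have hrw : 2.3869 * (1 + (0.12 * u ^ 2 + 1.262 * u - 0.598) / (3 + u)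
      + ((0.12 * u ^ 2 + 1.262 * u - 0.598) / (3 + u)) ^ 2 / 2
      + ((0.12 * u ^ 2 + 1.262 * u - 0.598) / (3 + u)) ^ 3 / 6 - 0.0001)
      - (1.95 + 0.95 * u)
      = (2.3869 * (0.9999 * (3 + u) ^ 3 + (0.12 * u ^ 2 + 1.262 * u - 0.598) * (3 + u) ^ 2
      + (0.12 * u ^ 2 + 1.262 * u - 0.598) ^ 2 * (3 + u) / 2
      + (0.12 * u ^ 2 + 1.262 * u - 0.598) ^ 3 / 6)
      - (1.95 + 0.95 * u) * (3 + u) ^ 3) / (3 + u) ^ 3 := by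
    field_simp; ring
  rw [hrw]
  apply div_nonneg _ (by positivity)
  have hv : 0 ≤ 1 - u := sub_nonneg.mpr hu1
  have B (i j : ℕ) : 0 ≤ u ^ i * (1 - u) ^ j := by positivity
  nlinarith [B 0 6, B 1 5, B 2 4, B 3 3, B 4 2, B 5 1, B 6 0]

/-- The sign of `g₃` at a zero of `h₃`, in the variable `l = -log Q`. -/
theorem criticalValue_neg {n c l : ℝ} (hn : n ∈ Icc (2 : ℝ) 3) (hc : 1.55 ≤ c) (hl : 0 < l)
    (h : Real.exp ((n + 1) * l) = 1 + (n + 1) ^ 2 / n + (n + 1) * l) :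
    1 / 2 + n * l / (2 * (n - 1))
      - (Real.exp ((n - 1) * l) - 1) * (3 * n - 2) / (2 * (n - 1) ^ 2)
      + n / c * (l + n * l ^ 2 / (2 * (n + 1)) - 1 / (n + 1)) < 0 := by
  obtain ⟨u, rfl⟩ : ∃ u, n = 2 + u := ⟨n - 2, by ring⟩
  obtain ⟨hu0, hu1⟩ : 0 ≤ u ∧ u ≤ 1 := ⟨by linarith [hn.1], by linarith [hn.2]⟩
  have hv : 0 ≤ 1 - u := sub_nonneg.mpr hu1
  have B (i j : ℕ) : 0 ≤ u ^ i * (1 - u) ^ j := by positivity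
  have hm : (0 : ℝ) < 3 + u := by linarith
  rw [show 2 + u + 1 = 3 + u by ring] at *
  rw [show 2 + u - 1 = 1 + u by ring]
  set l₀ := (2.012 + 0.12 * u) / (3 + u) with hl₀
  have hml₀ : (3 + u) * l₀ = 2.012 + 0.12 * u := by rw [hl₀]; field_simp
  have hle : l₀ ≤ l := by
    by_contra! hlt
    have h1 := exp_sub_self_lt_exp_sub_self (by positivity)
      (mul_lt_mul_of_pos_left hlt hm)
    rw [hml₀, h] at h1
    have h2 := exp_seed_le hu0 hu1
    have h3 : (3 + u) ^ 2 / (2 + u) = 4 + u + 1 / (2 + u) := by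
      field_simp; ring
    linarith
  obtain ⟨δ, rfl⟩ : ∃ δ, l = l₀ + δ := ⟨l - l₀, by ring⟩
  have hδ : 0 ≤ δ := by linarith
  have hl₀pos : 0 < l₀ := by positivity
  have hX : (1.95 + 0.95 * u) * (1 + (1 + u) * δ + ((1 + u) * δ) ^ 2 / 2)
      ≤ Real.exp ((1 + u) * (l₀ + δ)) := by
    rw [show (1 + u) * (l₀ + δ) = (1 + u) * l₀ + (1 + u) * δ by ring, Real.exp_add]
    gcongr
    · exact le_exp_seed hu0 hu1
    · exact Real.quadratic_le_exp_of_nonneg (by positivity)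
  have hbr : 0 ≤ (l₀ + δ) + (2 + u) * (l₀ + δ) ^ 2 / (2 * (3 + u)) - 1 / (3 + u) := by
    have h1 : 1 / (3 + u) ≤ l₀ := by rw [hl₀]; gcongr; linarith
    have h2 : 0 ≤ (2 + u) * (l₀ + δ) ^ 2 / (2 * (3 + u)) := by positivity
    linarith
  have hcmono : (2 + u) / c ≤ (2 + u) * (20 / 31) := by
    rw [div_le_iff₀ (by linarith)]
    nlinarith
  have hG0 : 1 / 2 + (2 + u) * l₀ / (2 * (1 + u))
      - (0.95 + 0.95 * u) * (3 * (2 + u) - 2) / (2 * (1 + u) ^ 2)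
      + (2 + u) * (20 / 31) * (l₀ + (2 + u) * l₀ ^ 2 / (2 * (3 + u)) - 1 / (3 + u)) < 0 := by
    have hrw : 1 / 2 + (2 + u) * l₀ / (2 * (1 + u))
        - (0.95 + 0.95 * u) * (3 * (2 + u) - 2) / (2 * (1 + u) ^ 2)
        + (2 + u) * (20 / 31) * (l₀ + (2 + u) * l₀ ^ 2 / (2 * (3 + u)) - 1 / (3 + u))
        = -(0.95 * (4 + 3 * u) * (3 + u) ^ 3 - (1 + u) * (3 + u) ^ 3
          - (2 + u) * (2.012 + 0.12 * u) * (3 + u) ^ 2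
          - (2 + u) * (1 + u) * (20 / 31) * (2 * (1.012 + 0.12 * u) * (3 + u) ^ 2
            + (2 + u) * (2.012 + 0.12 * u) ^ 2)) / (2 * (1 + u) * (3 + u) ^ 3) := by
      rw [hl₀]; field_simp; ring
    rw [hrw]
    apply div_neg_of_neg_of_pos _ (by positivity)
    linarith [B 0 5, B 1 4, B 2 3, B 3 2, B 4 1, B 5 0]
  have hG1 : (2 + u) / (2 * (1 + u))
      - (1.95 + 0.95 * u) * (3 * (2 + u) - 2) / (2 * (1 + u))
      + (2 + u) * (20 / 31) * (1 + (2 + u) * l₀ / (3 + u)) ≤ 0 := by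
    have hrw : (2 + u) / (2 * (1 + u))
        - (1.95 + 0.95 * u) * (3 * (2 + u) - 2) / (2 * (1 + u))
        + (2 + u) * (20 / 31) * (1 + (2 + u) * l₀ / (3 + u))
        = -((1.95 + 0.95 * u) * (4 + 3 * u) * (3 + u) ^ 2 - (2 + u) * (3 + u) ^ 2
          - (2 + u) * (1 + u) * (40 / 31) * ((3 + u) ^ 2 + (2 + u) * (2.012 + 0.12 * u)))
          / (2 * (1 + u) * (3 + u) ^ 2) := by
      rw [hl₀]; field_simp; ring
    rw [hrw]
    apply div_nonpos_of_nonpos_of_nonneg _ (by positivity)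
    linarith [B 0 4, B 1 3, B 2 2, B 3 1, B 4 0]
  have hG2 : -((1.95 + 0.95 * u) * (3 * (2 + u) - 2) / 4)
      + (2 + u) * (20 / 31) * ((2 + u) / (2 * (3 + u))) ≤ 0 := by
    have h1 : (2 + u) / (2 * (3 + u)) ≤ 1 / 2 := by
      rw [div_le_div_iff₀ (by positivity) (by norm_num)]; linarith
    have h2 : (2 + u) * (20 / 31) * ((2 + u) / (2 * (3 + u))) ≤ (2 + u) * (20 / 31) * (1 / 2) := by
      gcongr
    refine (add_le_add_right h2 _).trans ?_
    nlinarith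
  calc _ ≤ 1 / 2 + (2 + u) * (l₀ + δ) / (2 * (1 + u))
      - ((1.95 + 0.95 * u) * (1 + (1 + u) * δ + ((1 + u) * δ) ^ 2 / 2) - 1)
        * (3 * (2 + u) - 2) / (2 * (1 + u) ^ 2)
      + (2 + u) * (20 / 31) * ((l₀ + δ) + (2 + u) * (l₀ + δ) ^ 2 / (2 * (3 + u)) - 1 / (3 + u)) := by
        gcongr
        linarith
    _ = (1 / 2 + (2 + u) * l₀ / (2 * (1 + u))
      - (0.95 + 0.95 * u) * (3 * (2 + u) - 2) / (2 * (1 + u) ^ 2)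
      + (2 + u) * (20 / 31) * (l₀ + (2 + u) * l₀ ^ 2 / (2 * (3 + u)) - 1 / (3 + u)))
      + ((2 + u) / (2 * (1 + u))
      - (1.95 + 0.95 * u) * (3 * (2 + u) - 2) / (2 * (1 + u))
      + (2 + u) * (20 / 31) * (1 + (2 + u) * l₀ / (3 + u))) * δ
      + (-((1.95 + 0.95 * u) * (3 * (2 + u) - 2) / 4)
      + (2 + u) * (20 / 31) * ((2 + u) / (2 * (3 + u)))) * δ ^ 2 := by
        field_simp
        ring
    _ < 0 := by nlinarith [mul_nonneg (neg_nonneg.mpr hG1) hδ,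
        mul_nonneg (neg_nonneg.mpr hG2) (sq_nonneg δ)]

theorem hasDerivAt_rpow_div {p q : ℝ} (hp : p ≠ 0) (hq : 0 < q) :
    HasDerivAt (fun x : ℝ => x ^ p / p) (q ^ (p - 1)) q := by
  have := (Real.hasDerivAt_rpow_const (p := p) (Or.inl hq.ne')).div_const p
  rwa [mul_div_cancel_left₀ _ hp] at this

theorem pos_of_mem_uIcc_one {q x : ℝ} (hq : 0 < q) (hx : x ∈ uIcc 1 q) : 0 < x :=
  (lt_min one_pos hq).trans_le hx.1

theorem F2_eq {n : ℝ} (hn : 1 < n) (d c μ : ℝ) {Q : ℝ} (hQ : 0 < Q) :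
    F2 d n c Q μ =
      1 / (n - 1) * ((Q ^ (n + 1) - 1) / (n + 1) - (Q ^ (2 : ℝ) - 1) / 2)
      - n / c * (Q ^ (n + 1) / (n + 1) * Real.log Q - (Q ^ (n + 1) - 1) / (n + 1) ^ 2)
      + μ * d * ((Q ^ (n + 1) - 1) / (n + 1)) := by
  have hn1 : n + 1 ≠ 0 := by linarith
  have hn2 : n - 1 ≠ 0 := by linarith
  have hderiv : ∀ q ∈ uIcc 1 Q, HasDerivAt (fun x : ℝ =>
      1 / (n - 1) * (x ^ (n + 1) / (n + 1) - x ^ (2 : ℝ) / 2)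
      - n / c * (x ^ (n + 1) / (n + 1) * Real.log x - x ^ (n + 1) / (n + 1) / (n + 1))
      + μ * d * (x ^ (n + 1) / (n + 1))) (F1 d n c q μ * q ^ n) q := by
    intro q hq
    have hq0 := pos_of_mem_uIcc_one hQ hq
    have h1 := hasDerivAt_rpow_div hn1 hq0
    have h2 := hasDerivAt_rpow_div (two_ne_zero (α := ℝ)) hq0
    have h := (((h1.sub h2).const_mul (1 / (n - 1))).sub
      (((h1.mul (Real.hasDerivAt_log hq0.ne')).sub (h1.div_const (n + 1))).const_mul
        (n / c))).add (h1.const_mul (μ * d))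
    refine h.congr_deriv ?_
    have e1 : q ^ (1 - n) * q ^ n = q := by
      rw [← Real.rpow_add hq0]; simp
    have e2 : q ^ (n + 1) = q ^ n * q := Real.rpow_add_one hq0.ne' n
    have e3 : q ^ ((2 : ℝ) - 1) = q := by norm_num
    rw [F1, e2, e3, add_sub_cancel_right]
    have e4 : q ^ n * q / (n + 1) * q⁻¹ = q ^ n / (n + 1) := by field_simp
    rw [e4]
    linear_combination (1 / (n - 1)) * e1
  have hcont : ContinuousOn (fun q => F1 d n c q μ * q ^ n) (uIcc 1 Q) := by
    have h0 : ∀ x ∈ uIcc 1 Q, x ≠ 0 := fun x hx => (pos_of_mem_uIcc_one hQ hx).ne'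
    have hp (p : ℝ) : ContinuousOn (fun x : ℝ => x ^ p) (uIcc 1 Q) :=
      continuousOn_id.rpow_const fun x hx => Or.inl (h0 x hx)
    have hlog : ContinuousOn Real.log (uIcc 1 Q) := Real.continuousOn_log.mono h0
    unfold F1
    exact (((((hp _).sub continuousOn_const).const_mul _).sub (hlog.const_mul _)).add
      continuousOn_const).mul (hp n)
  rw [F2, integral_eq_sub_of_hasDerivAt hderiv hcont.intervalIntegrable]
  simp only [Real.one_rpow, Real.log_one]
  field_simp
  ring

theorem F3_eq {n : ℝ} (hn : 1 < n) (d c μ : ℝ) {Q : ℝ} (hQ : 0 < Q) :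
    F3 d n c Q μ = F1 d n c Q μ - n *
      ((1 / ((n - 1) * (n + 1)) + n / (c * (n + 1) ^ 2) + μ * d / (n + 1))
        * (Real.log Q + (Q ^ (-(n + 1)) - 1) / (n + 1))
      + 1 / (2 * (n - 1)) * ((Q ^ (1 - n) - 1) / (n - 1) - (Q ^ (-(n + 1)) - 1) / (n + 1))
      - n / (2 * c * (n + 1)) * Real.log Q ^ 2) := by
  have hn1 : n + 1 ≠ 0 := by linarith
  have hn3 : 1 - n ≠ 0 := by linarith
  have hderiv : ∀ q ∈ uIcc 1 Q, HasDerivAt (fun x : ℝ =>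
      (1 / ((n - 1) * (n + 1)) + n / (c * (n + 1) ^ 2) + μ * d / (n + 1))
        * (Real.log x + -(x ^ (-(n + 1)) / (-(n + 1))))
      + 1 / (2 * (n - 1)) * (-(x ^ (1 - n) / (1 - n)) + x ^ (-(n + 1)) / (-(n + 1)))
      - n / (2 * c * (n + 1)) * Real.log x ^ 2) (F2 d n c q μ * q ^ (-(n + 2))) q := by
    intro q hq
    have hq0 := pos_of_mem_uIcc_one hQ hq
    have h1 := hasDerivAt_rpow_div (neg_ne_zero.mpr hn1) hq0
    have h2 := hasDerivAt_rpow_div hn3 hq0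
    have hl := Real.hasDerivAt_log hq0.ne'
    have h := (((hl.add h1.neg).const_mul
      (1 / ((n - 1) * (n + 1)) + n / (c * (n + 1) ^ 2) + μ * d / (n + 1))).add
      ((h2.neg.add h1).const_mul (1 / (2 * (n - 1))))).sub
      ((hl.pow 2).const_mul (n / (2 * c * (n + 1))))
    refine h.congr_deriv ?_
    have e1 : q ^ (n + 1) * q ^ (-(n + 2)) = q⁻¹ := by
      rw [← Real.rpow_add hq0, ← Real.rpow_neg_one]; congr 1; ring
    have e2 : q ^ (2 : ℝ) * q ^ (-(n + 2)) = q ^ (-n) := by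
      rw [← Real.rpow_add hq0]; congr 1; ring
    rw [F2_eq hn d c μ hq0, show 1 - n - 1 = -n by ring,
      show -(n + 1) - 1 = -(n + 2) by ring]
    have key : ∀ A B L P D I : ℝ, A * D = I → B * D = P →
        (1 / (n - 1) * ((A - 1) / (n + 1) - (B - 1) / 2)
          - n / c * (A / (n + 1) * L - (A - 1) / (n + 1) ^ 2)
          + μ * d * ((A - 1) / (n + 1))) * D
        = (1 / ((n - 1) * (n + 1)) + n / (c * (n + 1) ^ 2) + μ * d / (n + 1)) * (I + -D)
          + 1 / (2 * (n - 1)) * (-P + D) - n / (2 * c * (n + 1)) * (2 * L * I) := by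
      rintro A B L P D I rfl rfl
      rw [mul_comm c, mul_comm (2 * c)]
      simp only [div_eq_mul_inv, mul_inv]
      ring
    rw [key _ _ (Real.log q) _ _ _ e1 e2]
    norm_num
  have hcont : ContinuousOn (fun q => F2 d n c q μ * q ^ (-(n + 2))) (uIcc 1 Q) := by
    have h0 : ∀ x ∈ uIcc 1 Q, x ≠ 0 := fun x hx => (pos_of_mem_uIcc_one hQ hx).ne'
    have hp (p : ℝ) : ContinuousOn (fun x : ℝ => x ^ p) (uIcc 1 Q) :=
      continuousOn_id.rpow_const fun x hx => Or.inl (h0 x hx)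
    have hlog : ContinuousOn Real.log (uIcc 1 Q) := Real.continuousOn_log.mono h0
    refine ContinuousOn.mul ?_ (hp _)
    refine ContinuousOn.congr ?_ fun x hx => F2_eq hn d c μ (pos_of_mem_uIcc_one hQ hx)
    have hA : ContinuousOn (fun x : ℝ => x ^ (n + 1) - 1) (uIcc 1 Q) :=
      (hp _).sub continuousOn_const
    have hB : ContinuousOn (fun x : ℝ => x ^ (2 : ℝ) - 1) (uIcc 1 Q) :=
      (hp _).sub continuousOn_const
    exact ((((hA.div_const _).sub (hB.div_const _)).const_mul _).sub
      (((((hp _).div_const _).mul hlog).sub (hA.div_const _)).const_mul _)).add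
      ((hA.div_const _).const_mul _)
  rw [F3, integral_eq_sub_of_hasDerivAt hderiv hcont.intervalIntegrable]
  simp only [Real.one_rpow, Real.log_one]
  congr 2
  rw [← neg_sub n 1]
  simp only [div_neg]
  ring

/-- The coefficient `h₃` of `μ` in the affine function `F₃`. -/
theorem F3_sub_F3_zero {n : ℝ} (hn : 1 < n) (d c μ : ℝ) {Q : ℝ} (hQ : 0 < Q) :
    F3 d n c Q μ - F3 d n c Q 0 =
      μ * (d * (1 - n / (n + 1) * (Real.log Q + (Q ^ (-(n + 1)) - 1) / (n + 1)))) := by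
  rw [F3_eq hn d c μ hQ, F3_eq hn d c 0 hQ, F1, F1]
  ring

theorem log_add_rpow_neg_lt {m a b : ℝ} (hm : 0 < m) (ha : 0 < a) (hab : a < b) (hb : b ≤ 1) :
    Real.log b + (b ^ (-m) - 1) / m < Real.log a + (a ^ (-m) - 1) / m := by
  have hb0 := ha.trans hab
  have hlog := Real.log_lt_log ha hab
  have h := exp_sub_self_lt_exp_sub_self (a := Real.log b * -m) (b := Real.log a * -m)
    (by nlinarith [Real.log_nonpos hb0.le hb]) (by nlinarith)
  rw [← Real.rpow_def_of_pos ha, ← Real.rpow_def_of_pos hb0] at h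
  rw [← sub_pos]
  have : Real.log a + (a ^ (-m) - 1) / m - (Real.log b + (b ^ (-m) - 1) / m)
      = ((a ^ (-m) - Real.log a * -m) - (b ^ (-m) - Real.log b * -m)) / m := by
    field_simp; ring
  rw [this]
  exact div_pos (sub_pos.mpr h) hm

theorem continuousAt_F3 {n : ℝ} (hn : 1 < n) (d c μ : ℝ) {Q : ℝ} (hQ : 0 < Q) :
    ContinuousAt (fun x => F3 d n c x μ) Q := by
  have hp (p : ℝ) : ContinuousAt (fun x : ℝ => x ^ p) Q :=
    Real.continuousAt_rpow_const Q p (Or.inl hQ.ne')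
  have hlog : ContinuousAt Real.log Q := Real.continuousAt_log hQ.ne'
  have hev : (fun x => F3 d n c x μ) =ᶠ[𝓝 Q] _ :=
    (eventually_gt_nhds hQ).mono fun x hx => F3_eq hn d c μ hx
  refine ContinuousAt.congr ?_ hev.symm
  unfold F1
  fun_prop (disch := exact Or.inl hQ.ne')

theorem F3_zero_neg {d n c Q : ℝ} (hn : n ∈ Icc (2 : ℝ) 3) (hc : 1.55 ≤ c)
    (hQ : Q ∈ Ioo (0 : ℝ) 1)
    (hroot : n / (n + 1) * (Real.log Q + (Q ^ (-(n + 1)) - 1) / (n + 1)) = 1) :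
    F3 d n c Q 0 < 0 := by
  have hn1 : 1 < n := by linarith [hn.1]
  have hn2 : n - 1 ≠ 0 := by linarith
  have hc0 : c ≠ 0 := by linarith
  have hlog : 0 < -Real.log Q := neg_pos.mpr (Real.log_neg hQ.1 hQ.2)
  have hexp (p : ℝ) : Q ^ p = Real.exp (-p * -Real.log Q) := by
    rw [Real.rpow_def_of_pos hQ.1]; congr 1; ring
  have hX := hexp (1 - n)
  have hY := hexp (-(n + 1))
  rw [neg_neg] at hY
  rw [neg_sub] at hX
  have hroot' : Q ^ (-(n + 1)) = 1 + (n + 1) ^ 2 / n + (n + 1) * -Real.log Q := by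
    field_simp at hroot ⊢
    linarith
  have hneg := criticalValue_neg hn hc hlog (hY.symm.trans hroot')
  rw [← hX] at hneg
  refine lt_of_eq_of_lt ?_ hneg
  rw [F3_eq hn1 d c 0 hQ.1, F1, hroot']
  field_simp
  ring

/-- g₃(Q_*) < 0, F₃(Q_*, μ) = g₃(Q_*) for all μ, and μ₃ blows up as Q → Q_*⁺
(Lemma on μᵢ properties, item (3)). -/
theorem magma_F3_at_Qstar
    (d n c Qs : ℝ) (hd : 0 < d) (hn : n ∈ Icc (2:ℝ) 3) (hc : c ∈ Ico (1.55:ℝ) n)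
    (hQs : Qs ∈ Ioo (0:ℝ) 1) (hQsz : F3 d n c Qs 1 - F3 d n c Qs 0 = 0)
    (hQsu : ∀ Q ∈ Ioo (0:ℝ) 1, F3 d n c Q 1 - F3 d n c Q 0 = 0 → Q = Qs) :
    F3 d n c Qs 0 < 0 ∧ (∀ μ : ℝ, F3 d n c Qs μ = F3 d n c Qs 0) ∧
      Tendsto (mu3 d n c) (𝓝[>] Qs) atTop := by
  have hn1 : 1 < n := by linarith [hn.1]
  have hroot : n / (n + 1) * (Real.log Qs + (Qs ^ (-(n + 1)) - 1) / (n + 1)) = 1 := by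
    have h := hQsz
    rw [F3_sub_F3_zero hn1 d c 1 hQs.1, one_mul, mul_eq_zero] at h
    linarith [h.resolve_left hd.ne']
  have hneg : F3 d n c Qs 0 < 0 := F3_zero_neg hn hc.1 hQs hroot
  refine ⟨hneg, fun μ => ?_, ?_⟩
  · rw [← sub_eq_zero, F3_sub_F3_zero hn1 d c μ hQs.1, hroot]
    ring
  · have hnum : Tendsto (fun Q => -F3 d n c Q 0) (𝓝[>] Qs) (𝓝 (-F3 d n c Qs 0)) :=
      ((continuousAt_F3 hn1 d c 0 hQs.1).neg).tendsto.mono_left nhdsWithin_le_nhds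
    have hden : Tendsto (fun Q => F3 d n c Q 1 - F3 d n c Q 0) (𝓝[>] Qs) (𝓝[>] 0) := by
      refine tendsto_nhdsWithin_iff.mpr ⟨?_, ?_⟩
      · have h := (continuousAt_F3 hn1 d c 1 hQs.1).tendsto.sub
          (continuousAt_F3 hn1 d c 0 hQs.1).tendsto
        rw [hQsz] at h
        exact h.mono_left nhdsWithin_le_nhds
      · filter_upwards [Ioo_mem_nhdsGT hQs.2] with Q hQ
        rw [mem_Ioi, F3_sub_F3_zero hn1 d c 1 (hQs.1.trans hQ.1), one_mul]
        have h1 := mul_lt_mul_of_pos_left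
          (log_add_rpow_neg_lt (m := n + 1) (by linarith) hQs.1 hQ.1 hQ.2.le)
          (show 0 < n / (n + 1) by positivity)
        rw [hroot] at h1
        exact mul_pos hd (sub_pos.mpr h1)
    have h := hnum.pos_mul_atTop (neg_pos.mpr hneg) hden.inv_tendsto_nhdsGT_zero
    exact h.congr fun Q => (div_eq_mul_inv _ _).symm
end
end

section
/- Let d ∈ ℕ with d ≥ 1, n ∈ [2,3], and c ∈ [1.55, n). Then the set A is an open subset of ℝ. -/
open Set Filter Topology intervalIntegral Real

noncomputable section

/-- The weighted average `∫₀¹ tᵏ g(rt) dt`. -/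
def weightedAvg (k : ℕ) (g : ℝ → ℝ) (r : ℝ) : ℝ :=
  ∫ t in (0:ℝ)..1, t ^ k * g (r * t)

theorem continuous_weightedAvg (k : ℕ) {g : ℝ → ℝ} (hg : Continuous g) :
    Continuous (weightedAvg k g) := by
  unfold weightedAvg
  apply intervalIntegral.continuous_parametric_intervalIntegral_of_continuous'
  fun_prop

theorem mul_mem_Icc_of_mem {R r t : ℝ} (hr : r ∈ Icc 0 R) (ht : t ∈ Icc (0:ℝ) 1) :
    r * t ∈ Icc 0 R :=
  ⟨mul_nonneg hr.1 ht.1, (mul_le_of_le_one_right hr.1 ht.2).trans hr.2⟩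

theorem weightedAvg_congr (k : ℕ) {g h : ℝ → ℝ} {R r : ℝ} (hr : r ∈ Icc 0 R)
    (hgh : ∀ s ∈ Icc 0 R, g s = h s) : weightedAvg k g r = weightedAvg k h r := by
  unfold weightedAvg
  apply intervalIntegral.integral_congr
  intro t ht
  rw [uIcc_of_le zero_le_one] at ht
  simp only [hgh _ (mul_mem_Icc_of_mem hr ht)]

theorem abs_weightedAvg_sub_le (k : ℕ) {g h : ℝ → ℝ} {R r B : ℝ} (hg : Continuous g)
    (hh : Continuous h) (hr : r ∈ Icc 0 R) (hgh : ∀ s ∈ Icc 0 R, |g s - h s| ≤ B) :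
    |weightedAvg k g r - weightedAvg k h r| ≤ B := by
  unfold weightedAvg
  rw [← intervalIntegral.integral_sub (by apply Continuous.intervalIntegrable; fun_prop)
    (by apply Continuous.intervalIntegrable; fun_prop)]
  have := intervalIntegral.norm_integral_le_of_norm_le_const (a := (0:ℝ)) (b := 1) (C := B)
    (f := fun t => t ^ k * g (r * t) - t ^ k * h (r * t)) ?_
  · simpa using this
  · intro t ht
    rw [uIoc_of_le zero_le_one] at ht
    have h1 := hgh _ (mul_mem_Icc_of_mem hr ⟨ht.1.le, ht.2⟩)
    have h2 : t ^ k ≤ 1 := pow_le_one₀ ht.1.le ht.2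
    have h3 : 0 ≤ t ^ k := pow_nonneg ht.1.le k
    rw [← mul_sub, Real.norm_eq_abs, abs_mul, abs_of_nonneg h3]
    exact (mul_le_of_le_one_left (abs_nonneg _) h2).trans h1

theorem pow_mul_weightedAvg (k : ℕ) (g : ℝ → ℝ) (r : ℝ) :
    r ^ k * (r * weightedAvg k g r) = ∫ s in (0:ℝ)..r, s ^ k * g s := by
  have h := intervalIntegral.mul_integral_comp_mul_left (a := 0) (b := 1)
    (f := fun s => s ^ k * g s) r
  rw [mul_zero, mul_one] at h
  rw [← h, weightedAvg, mul_left_comm, ← intervalIntegral.integral_const_mul]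
  simp only [mul_pow, mul_assoc]

theorem weightedAvg_zero (k : ℕ) (g : ℝ → ℝ) : weightedAvg k g 0 = g 0 / (k + 1) := by
  simp [weightedAvg, div_eq_inv_mul]

theorem hasDerivAt_mul_weightedAvg (k : ℕ) {g : ℝ → ℝ} (hg : Continuous g) (r : ℝ) :
    HasDerivAt (fun s => s * weightedAvg k g s) (g r - k * weightedAvg k g r) r := by
  rcases eq_or_ne r 0 with rfl | hr
  · have h0 : g 0 - k * weightedAvg k g 0 = weightedAvg k g 0 := by
      rw [weightedAvg_zero]; field_simp; ring
    rw [h0, hasDerivAt_iff_tendsto_slope]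
    refine (((continuous_weightedAvg k hg).tendsto 0).mono_left nhdsWithin_le_nhds).congr' ?_
    filter_upwards [self_mem_nhdsWithin] with s hs
    have hs : s ≠ 0 := hs
    simp [slope_def_field, hs]
  · have hc : Continuous fun s => s ^ k * g s := by fun_prop
    have h1 : HasDerivAt (fun s => ∫ u in (0:ℝ)..s, u ^ k * g u) (r ^ k * g r) r :=
      intervalIntegral.integral_hasDerivAt_right (hc.intervalIntegrable _ _)
        (hc.stronglyMeasurableAtFilter _ _) hc.continuousAt
    have h2 := h1.div (hasDerivAt_pow k r) (pow_ne_zero k hr)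
    have h3 : (fun s => s * weightedAvg k g s) =ᶠ[𝓝 r]
        ((fun s => ∫ u in (0:ℝ)..s, u ^ k * g u) / fun s => s ^ k) := by
      filter_upwards [isOpen_ne.mem_nhds hr] with s hs
      have hs : s ^ k ≠ 0 := pow_ne_zero k hs
      simp only [Pi.div_apply, ← pow_mul_weightedAvg]
      field_simp
    refine (h2.congr_of_eventuallyEq h3).congr_deriv ?_
    rw [← pow_mul_weightedAvg]
    rcases k with _ | k
    · simp
    · have : r ^ k ≠ 0 := pow_ne_zero k hr
      simp only [Nat.add_sub_cancel, pow_succ]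
      push_cast
      field_simp

theorem weightedAvg_eq_of_hasDerivAt (k : ℕ) {g h : ℝ → ℝ} (hg : ∀ s, HasDerivAt g (h s) s)
    (hh : Continuous h) (r : ℝ) :
    (k + 1) * weightedAvg k g r = g r - r * weightedAvg (k + 1) h r := by
  have hgc : Continuous g := continuous_iff_continuousAt.2 fun s => (hg s).continuousAt
  have hd : ∀ t ∈ uIcc (0:ℝ) 1, HasDerivAt (fun t => t ^ (k + 1) * g (r * t))
      ((k + 1) * (t ^ k * g (r * t)) + r * (t ^ (k + 1) * h (r * t))) t := by
    intro t _
    have h1 : HasDerivAt (fun t => g (r * t)) (h (r * t) * r) t := by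
      have := (hg (r * t)).comp t ((hasDerivAt_id t).const_mul r)
      simpa [Function.comp_def] using this
    refine ((hasDerivAt_pow (k + 1) t).mul h1).congr_deriv ?_
    push_cast
    ring
  have hi := intervalIntegral.integral_eq_sub_of_hasDerivAt hd
    (by apply Continuous.intervalIntegrable; fun_prop)
  rw [intervalIntegral.integral_add (by apply Continuous.intervalIntegrable; fun_prop)
    (by apply Continuous.intervalIntegrable; fun_prop), intervalIntegral.integral_const_mul,
    intervalIntegral.integral_const_mul] at hi
  simp only [one_pow, mul_one, one_mul, ne_eq, Nat.succ_ne_zero, not_false_eq_true,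
    zero_pow, zero_mul, sub_zero] at hi
  simp only [weightedAvg]
  linarith

theorem hasDerivAt_weightedAvg (k : ℕ) {g h : ℝ → ℝ} (hg : ∀ s, HasDerivAt g (h s) s)
    (hh : Continuous h) (r : ℝ) :
    HasDerivAt (weightedAvg k g) (weightedAvg (k + 1) h r) r := by
  have h0 : (k + 1 : ℝ) ≠ 0 := by positivity
  have h1 : weightedAvg k g = fun s => (g s - s * weightedAvg (k + 1) h s) / (k + 1) := by
    funext s
    rw [← weightedAvg_eq_of_hasDerivAt k hg hh s]
    field_simp
  rw [h1]
  refine (((hg r).sub (hasDerivAt_mul_weightedAvg (k + 1) hh r)).div_const _).congr_deriv ?_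
  push_cast
  field_simp
  ring

theorem eq_mul_weightedAvg_of_hasDerivAt (k : ℕ) {p g : ℝ → ℝ} {R : ℝ}
    (hp : ContinuousOn p (Icc 0 R)) (hg : Continuous g) (hp0 : p 0 = 0)
    (hd : ∀ r ∈ Ioo 0 R, HasDerivAt p (g r - k * (p r / r)) r) :
    ∀ r ∈ Icc 0 R, p r = r * weightedAvg k g r := by
  intro r hr
  rcases hr.1.eq_or_lt with rfl | hr0
  · simp [hp0]
  have hi := intervalIntegral.integral_eq_sub_of_hasDerivAt_of_le hr.1
    (f := fun s => s ^ k * p s) (f' := fun s => s ^ k * g s)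
    ((continuous_pow k).continuousOn.mul (hp.mono (Icc_subset_Icc_right hr.2))) ?_
    (by apply Continuous.intervalIntegrable; fun_prop)
  · rw [← pow_mul_weightedAvg] at hi
    simp only [hp0, mul_zero, sub_zero] at hi
    exact (mul_left_cancel₀ (pow_ne_zero k hr0.ne') hi).symm
  · intro s hs
    refine ((hasDerivAt_pow k s).mul (hd s ⟨hs.1, hs.2.trans_le hr.2⟩)).congr_deriv ?_
    have hs0 : s ≠ 0 := hs.1.ne'
    rcases k with _ | k
    · simp
    · simp only [Nat.add_sub_cancel, pow_succ]
      push_cast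
      field_simp
      ring

theorem mul_integral_exp_mul (l r : ℝ) :
    l * (r * ∫ t in (0:ℝ)..1, exp (l * (r * t))) = exp (l * r) - 1 := by
  have hd : ∀ t ∈ uIcc (0:ℝ) 1, HasDerivAt (fun t => exp (l * (r * t)))
      (l * r * exp (l * (r * t))) t := by
    intro t _
    refine ((((hasDerivAt_id t).const_mul r).const_mul l).exp).congr_deriv ?_
    simp only [id]
    ring
  have hi := intervalIntegral.integral_eq_sub_of_hasDerivAt hd
    (by apply Continuous.intervalIntegrable; fun_prop)
  rw [intervalIntegral.integral_const_mul] at hi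
  simp only [mul_one, mul_zero, exp_zero] at hi
  linarith

section Volterra

variable {ι : Type*} [Fintype ι]

/-- Exponentially rescaled Volterra operator on continuous curves over `[0, R]`. -/
def volterraMap {R : ℝ} (hR : 0 ≤ R) (l : ℝ) (k : ι → ℕ) (a : ι → ℝ)
    (f : (ι → ℝ) → ι → ℝ) (hf : Continuous f) (z : C(Icc 0 R, ι → ℝ)) : C(Icc 0 R, ι → ℝ) where
  toFun r i := exp (-(l * r)) *
    (a i + r * weightedAvg (k i) (fun s => f (exp (l * s) • IccExtend hR z s) i) r)
  continuous_toFun := by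
    have hz : Continuous (IccExtend hR z) := z.continuous.Icc_extend'
    refine continuous_pi fun i => ?_
    have h := continuous_weightedAvg (k i)
      (g := fun s => f (exp (l * s) • IccExtend hR z s) i) (by fun_prop)
    fun_prop

theorem dist_volterraMap_le {R : ℝ} (hR : 0 ≤ R) {L : NNReal} (k : ι → ℕ) (a : ι → ℝ)
    {f : (ι → ℝ) → ι → ℝ} (hf : LipschitzWith L f) (z w : C(Icc 0 R, ι → ℝ)) :
    dist (volterraMap hR (2 * L + 1) k a f hf.continuous z)
      (volterraMap hR (2 * L + 1) k a f hf.continuous w) ≤ 1 / 2 * dist z w := by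
  have hz : Continuous (IccExtend hR z) := z.continuous.Icc_extend'
  have hw : Continuous (IccExtend hR w) := w.continuous.Icc_extend'
  have hfc := hf.continuous
  set l : ℝ := 2 * L + 1 with hl
  have hl0 : 0 < l := by positivity
  rw [ContinuousMap.dist_le (by positivity)]
  intro r
  rw [dist_pi_le_iff (by positivity)]
  intro i
  obtain ⟨r, hr⟩ := r
  simp only [volterraMap, ContinuousMap.coe_mk, Real.dist_eq, weightedAvg]
  have key : |(∫ t in (0:ℝ)..1, t ^ k i * f (exp (l * (r * t)) • IccExtend hR z (r * t)) i) -
      ∫ t in (0:ℝ)..1, t ^ k i * f (exp (l * (r * t)) • IccExtend hR w (r * t)) i| ≤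
      ∫ t in (0:ℝ)..1, L * dist z w * exp (l * (r * t)) := by
    rw [← intervalIntegral.integral_sub (by apply Continuous.intervalIntegrable; fun_prop)
      (by apply Continuous.intervalIntegrable; fun_prop), ← Real.norm_eq_abs]
    refine intervalIntegral.norm_integral_le_of_norm_le zero_le_one ?_
      (by apply Continuous.intervalIntegrable; fun_prop)
    filter_upwards with t ht
    have h2 : t ^ k i ≤ 1 := pow_le_one₀ ht.1.le ht.2
    have h3 : 0 ≤ t ^ k i := pow_nonneg ht.1.le _
    rw [← mul_sub, Real.norm_eq_abs, abs_mul, abs_of_nonneg h3]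
    refine (mul_le_of_le_one_left (abs_nonneg _) h2).trans ?_
    rw [← Real.dist_eq]
    refine (dist_le_pi_dist _ _ i).trans ((hf.dist_le_mul _ _).trans ?_)
    rw [dist_smul₀, Real.norm_eq_abs, abs_of_pos (exp_pos _), mul_assoc,
      mul_comm (exp _) (dist _ _)]
    gcongr
    exact ContinuousMap.dist_apply_le_dist _
  rw [intervalIntegral.integral_const_mul] at key
  have h4 := mul_integral_exp_mul l r
  set I := ∫ t in (0:ℝ)..1, exp (l * (r * t))
  rw [← mul_sub, add_sub_add_left_eq_sub, ← mul_sub, abs_mul, abs_mul, abs_of_pos (exp_pos _),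
    abs_of_nonneg hr.1]
  have hD : 0 ≤ dist z w := dist_nonneg
  have hrI : r * I ≤ exp (l * r) / l := by
    rw [le_div_iff₀ hl0]; linarith
  calc _ ≤ exp (-(l * r)) * (r * (L * dist z w * I)) := by
        gcongr; exact hr.1
    _ = exp (-(l * r)) * (L * dist z w * (r * I)) := by ring
    _ ≤ exp (-(l * r)) * (L * dist z w * (exp (l * r) / l)) := by gcongr
    _ = (exp (-(l * r)) * exp (l * r)) * (L / l) * dist z w := by ring
    _ = (L / l) * dist z w := by rw [← exp_add]; simp
    _ ≤ 1 / 2 * dist z w := by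
        refine mul_le_mul_of_nonneg_right ?_ hD
        rw [div_le_iff₀ hl0]; linarith

/-- Existence of solutions of a Volterra equation close to a given approximate solution. -/
theorem exists_volterra_solution_near {R : ℝ} (hR : 0 ≤ R) {L : NNReal} (k : ι → ℕ)
    (a : ι → ℝ) {f : (ι → ℝ) → ι → ℝ} (hf : LipschitzWith L f) {y : ℝ → ι → ℝ}
    (hy : Continuous y) {ε : ℝ} (hε : 0 ≤ ε)
    (hyε : ∀ r ∈ Icc 0 R, ∀ i,
      |y r i - (a i + r * weightedAvg (k i) (fun s => f (y s) i) r)| ≤ ε) :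
    ∃ x : ℝ → ι → ℝ, Continuous x ∧
      (∀ r ∈ Icc 0 R, ∀ i, x r i = a i + r * weightedAvg (k i) (fun s => f (x s) i) r) ∧
      (∀ r ∈ Icc 0 R, ∀ i, |y r i - x r i| ≤ exp ((2 * L + 1) * R) * (2 * ε)) := by
  set l : ℝ := 2 * L + 1 with hl
  have hl0 : 0 < l := by positivity
  have hfc := hf.continuous
  let T := volterraMap hR l k a f hf.continuous
  have hT : ContractingWith (1 / 2) T := by
    refine ⟨by rw [← NNReal.coe_lt_coe]; norm_num, LipschitzWith.of_dist_le_mul fun z w => ?_⟩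
    simpa using dist_volterraMap_le hR k a hf z w
  let z₀ : C(Icc 0 R, ι → ℝ) := ⟨fun r => exp (-(l * r)) • y r, by fun_prop⟩
  have : Nonempty C(Icc 0 R, ι → ℝ) := ⟨z₀⟩
  set z := hT.fixedPoint T with hz
  have hTz : T z = z := hT.fixedPoint_isFixedPt
  have hext : ∀ (u : C(Icc 0 R, ι → ℝ)) (r) (hr : r ∈ Icc 0 R), IccExtend hR u r = u ⟨r, hr⟩ :=
    fun u r hr => IccExtend_of_mem hR u hr
  have hee : ∀ r, exp (l * r) * exp (-(l * r)) = 1 := fun r => by rw [← exp_add]; simp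
  have hz0 : dist z₀ (T z₀) ≤ ε := by
    rw [ContinuousMap.dist_le hε]
    rintro ⟨r, hr⟩
    rw [dist_pi_le_iff hε]
    intro i
    have h1 : weightedAvg (k i) (fun s => f (exp (l * s) • IccExtend hR z₀ s) i) r =
        weightedAvg (k i) (fun s => f (y s) i) r := by
      refine weightedAvg_congr _ hr fun s hs => ?_
      rw [hext z₀ s hs]
      simp [z₀, smul_smul, hee]
    simp only [T, z₀, volterraMap, ContinuousMap.coe_mk, Pi.smul_apply, smul_eq_mul,
      Real.dist_eq] at h1 ⊢
    rw [h1, ← mul_sub, abs_mul, abs_of_pos (exp_pos _)]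
    refine (mul_le_of_le_one_left (abs_nonneg _) ?_).trans (hyε r hr i)
    exact exp_le_one_iff.2 (neg_nonpos.2 (mul_nonneg hl0.le hr.1))
  have hdist : dist z₀ z ≤ 2 * ε := by
    refine (hT.dist_fixedPoint_le z₀).trans ?_
    have : (1 - ((1 / 2 : NNReal) : ℝ)) = 1 / 2 := by norm_num
    rw [this]
    linarith
  have hzc : Continuous (IccExtend hR z) := z.continuous.Icc_extend'
  refine ⟨fun r => exp (l * r) • IccExtend hR z r, by fun_prop, fun r hr i => ?_,
    fun r hr i => ?_⟩
  · have h1 : z ⟨r, hr⟩ i = T z ⟨r, hr⟩ i := by rw [hTz]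
    simp only [hext z r hr, Pi.smul_apply, smul_eq_mul]
    rw [h1]
    simp only [T, volterraMap, ContinuousMap.coe_mk]
    rw [← mul_assoc, hee, one_mul]
  · have h1 : |exp (-(l * r)) * y r i - z ⟨r, hr⟩ i| ≤ 2 * ε := by
      have h2 := (dist_le_pi_dist (z₀ ⟨r, hr⟩) (z ⟨r, hr⟩) i).trans
        ((ContinuousMap.dist_apply_le_dist _).trans hdist)
      simpa [z₀, Real.dist_eq] using h2
    simp only [hext z r hr, Pi.smul_apply, smul_eq_mul]
    have h3 : y r i - exp (l * r) * z ⟨r, hr⟩ i =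
        exp (l * r) * (exp (-(l * r)) * y r i - z ⟨r, hr⟩ i) := by
      rw [mul_sub, ← mul_assoc, hee, one_mul]
    rw [h3, abs_mul, abs_of_pos (exp_pos _)]
    gcongr
    exact hr.2

end Volterra

/-- Vector field of the first-order system satisfied by the profile, its derivative, and the
accumulated nonlinear damping term. -/
def magmaField (d n c μ : ℝ) (y : Fin 3 → ℝ) : Fin 3 → ℝ :=
  ![y 1, F1 d n c (y 0) μ - n * y 1 ^ 2 / (2 * y 0) - n * y 2, y 1 ^ 3 / (2 * y 0 ^ 2)]

/-- Exponents of the kernels in the integral form of the initial value problem. -/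
def magmaWeight (d : ℕ) : Fin 3 → ℕ := ![0, d - 1, 0]

/-- Initial data of the first-order system. -/
def magmaInit : Fin 3 → ℝ := ![1, 0, 0]

/-- Integral form of the initial value problem on `[0, R]`. -/
def IsMagmaCurve (d : ℕ) (n c μ R : ℝ) (y : ℝ → Fin 3 → ℝ) : Prop :=
  ∀ r ∈ Icc 0 R, ∀ i, y r i = magmaInit i +
    r * weightedAvg (magmaWeight d i) (fun s => magmaField d n c μ (y s) i) r

theorem hasDerivAt_F1 (d c μ : ℝ) {n q : ℝ} (hn : n ≠ 1) (hq : 0 < q) :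
    HasDerivAt (fun q => F1 d n c q μ) (q ^ (-n) - n / c / q) q := by
  have h1 : HasDerivAt (fun q : ℝ => q ^ (1 - n)) ((1 - n) * q ^ (1 - n - 1)) q :=
    Real.hasDerivAt_rpow_const (Or.inl hq.ne')
  have h2 := (((h1.sub_const 1).const_mul (-(1 / (n - 1)))).sub
    ((Real.hasDerivAt_log hq.ne').const_mul (n / c))).add_const (μ * d)
  refine h2.congr_deriv ?_
  have h3 : n - 1 ≠ 0 := sub_ne_zero.2 hn
  rw [show 1 - n - 1 = -n by ring]
  field_simp
  ring

theorem hasDerivAt_magmaField_one (d c μ : ℝ) {n : ℝ} (hn : n ≠ 1) {q p w : ℝ → ℝ} {s r : ℝ}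
    (hq0 : 0 < q r) (hq : HasDerivAt q (p r) r) (hp : HasDerivAt p s r)
    (hw : HasDerivAt w (p r ^ 3 / (2 * q r ^ 2)) r) :
    HasDerivAt (fun r => F1 d n c (q r) μ - n * p r ^ 2 / (2 * q r) - n * w r)
      (p r * (q r ^ (-n) - n / c / q r) - n * p r * s / q r) r := by
  have h1 := (hasDerivAt_F1 d c μ hn hq0).comp r hq
  have h2 := ((hp.pow 2).const_mul n).div (hq.const_mul 2) (by positivity)
  refine ((h1.sub h2).sub (hw.const_mul n)).congr_deriv ?_
  simp only [Pi.pow_apply]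
  field_simp
  ring

theorem magmaODE_iff {d n c r s t : ℝ} {Q : ℝ → ℝ} (hr : r ≠ 0) (hQ0 : 0 < Q r)
    (hQ : DifferentiableAt ℝ Q r) (hs : HasDerivAt (deriv Q) s r)
    (ht : HasDerivAt (deriv (deriv Q)) t r) :
    magmaODE d n c Q r ↔ t + (d - 1) * (s / r - deriv Q r / r ^ 2) =
      deriv Q r * (Q r ^ (-n) - n / c / Q r) - n * deriv Q r * s / Q r := by
  have h1 : HasDerivAt (fun s => Q s ^ n) (deriv Q r * n * Q r ^ (n - 1)) r :=
    hQ.hasDerivAt.rpow_const (Or.inl hQ0.ne')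
  have h2 := h1.mul ht
  have h3 := hs.div (hasDerivAt_id r) hr
  have e1 : deriv (fun s => Q s ^ n * deriv (deriv Q) s) r = _ := h2.deriv
  have e2 : deriv (fun s => deriv Q s / s) r = _ := h3.deriv
  have hX : 0 < Q r ^ n := rpow_pos_of_pos hQ0 n
  unfold magmaODE
  rw [h1.deriv, e1, e2, hs.deriv, rpow_sub_one hQ0.ne', rpow_neg hQ0.le]
  simp only [id]
  set X := Q r ^ n
  set P := deriv Q r
  have : -P + 1 / c * (P * n * (X / Q r)) + (P * n * (X / Q r) * s + X * t) +
      (d - 1) * X * ((s * r - P * 1) / r ^ 2) =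
      X * (t + (d - 1) * (s / r - P / r ^ 2) - (P * (X⁻¹ - n / c / Q r) - n * P * s / Q r)) := by
    rcases eq_or_ne c 0 with rfl | hc
    · simp only [div_zero]
      field_simp
      ring
    · field_simp
      ring
  rw [this, mul_eq_zero, or_iff_right hX.ne', sub_eq_zero]

theorem continuous_magmaField (d c μ : ℝ) {n : ℝ} (hn : n ≠ 1) {y : ℝ → Fin 3 → ℝ}
    (hy : Continuous y) (hpos : ∀ r, 0 < y r 0) : Continuous fun r => magmaField d n c μ (y r) := by
  have h0 : Continuous fun r => F1 d n c (y r 0) μ := continuous_iff_continuousAt.2 fun r =>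
    (hasDerivAt_F1 d c μ hn (hpos r)).continuousAt.comp
      (f := fun r => y r 0) (by fun_prop : Continuous fun r => y r 0).continuousAt
  have h1 : ∀ r, 2 * y r 0 ≠ 0 := fun r => mul_ne_zero two_ne_zero (hpos r).ne'
  have h2 : ∀ r, 2 * y r 0 ^ 2 ≠ 0 := fun r => mul_ne_zero two_ne_zero (pow_pos (hpos r) 2).ne'
  refine continuous_pi fun i => ?_
  fin_cases i
  · exact (by fun_prop : Continuous fun r => y r 1)
  · exact (h0.sub ((by fun_prop : Continuous fun r => n * y r 1 ^ 2).div (by fun_prop) h1)).sub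
      (by fun_prop)
  · exact (by fun_prop : Continuous fun r => y r 1 ^ 3).div (by fun_prop) h2

theorem contDiff_three_of_hasDerivAt {f f₁ f₂ f₃ : ℝ → ℝ} (h1 : ∀ r, HasDerivAt f (f₁ r) r)
    (h2 : ∀ r, HasDerivAt f₁ (f₂ r) r) (h3 : ∀ r, HasDerivAt f₂ (f₃ r) r) (hc : Continuous f₃) :
    ContDiff ℝ 3 f := by
  have e1 : deriv f = f₁ := funext fun r => (h1 r).deriv
  have e2 : deriv f₁ = f₂ := funext fun r => (h2 r).deriv
  have e3 : deriv f₂ = f₃ := funext fun r => (h3 r).deriv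
  have c1 : ContDiff ℝ 1 f₂ :=
    contDiff_one_iff_deriv.2 ⟨fun r => (h3 r).differentiableAt, e3 ▸ hc⟩
  have c2 : ContDiff ℝ (1 + 1) f₁ := contDiff_succ_iff_deriv.2
    ⟨fun r => (h2 r).differentiableAt, by simp, e2 ▸ c1⟩
  have c3 : ContDiff ℝ (1 + 1 + 1) f := contDiff_succ_iff_deriv.2
    ⟨fun r => (h1 r).differentiableAt, by simp, e1 ▸ c2⟩
  have : (3 : WithTop ℕ∞) = 1 + 1 + 1 := by norm_num
  rwa [this]

theorem hasDerivAt_primitive {g : ℝ → ℝ} (hg : Continuous g) (r : ℝ) :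
    HasDerivAt (fun s => ∫ u in (0:ℝ)..s, g u) (g r) r :=
  intervalIntegral.integral_hasDerivAt_right (hg.intervalIntegrable _ _)
    (hg.stronglyMeasurableAtFilter _ _) hg.continuousAt

theorem IsMagmaCurve.exists_isIVPSolutionOn {d : ℕ} (hd : 1 ≤ d) {n c μ R : ℝ} (hn : n ≠ 1)
    (hR : 0 < R) {y : ℝ → Fin 3 → ℝ} (hy : Continuous y) (hpos : ∀ r, 0 < y r 0)
    (h : IsMagmaCurve d n c μ R y) :
    ∃ Q, ContDiff ℝ 3 Q ∧ (∀ r ∈ Ioo (0:ℝ) R, magmaODE d n c Q r) ∧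
      Q 0 = 1 ∧ deriv Q 0 = 0 ∧ deriv (deriv Q) 0 = μ ∧
      ∀ r ∈ Icc 0 R, Q r = y r 0 ∧ deriv Q r = y r 1 := by
  obtain ⟨k, rfl⟩ : ∃ k, d = k + 1 := ⟨d - 1, by omega⟩
  have hF := continuous_magmaField ((k + 1 : ℕ) : ℝ) c μ hn hy hpos
  have hy0 : ∀ r ∈ Icc 0 R, y r 0 = 1 + r * weightedAvg 0 (fun s => y s 1) r :=
    fun r hr => h r hr 0
  have hy2 : ∀ r ∈ Icc 0 R,
      y r 2 = 0 + r * weightedAvg 0 (fun s => y s 1 ^ 3 / (2 * y s 0 ^ 2)) r :=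
    fun r hr => h r hr 2
  set g : ℝ → ℝ := fun s => magmaField ((k + 1 : ℕ) : ℝ) n c μ (y s) 1 with hg
  have hgc : Continuous g := by fun_prop
  have hy1 : ∀ r ∈ Icc 0 R, y r 1 = r * weightedAvg k g r := fun r hr =>
    (h r hr 1).trans (zero_add _)
  have hnhds : ∀ r ∈ Ioo 0 R, Icc 0 R ∈ 𝓝 r := fun r hr => Icc_mem_nhds hr.1 hr.2
  set P : ℝ → ℝ := fun r => r * weightedAvg k g r with hP
  set S : ℝ → ℝ := fun r => g r - k * weightedAvg k g r with hS
  have hvc := continuous_weightedAvg k hgc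
  let g' : ℝ → ℝ := fun r =>
    P r * (y r 0 ^ (-n) - n / c / y r 0) - n * P r * S r / y r 0
  have hg'c : Continuous g' := by
    have h1 : Continuous fun r => y r 0 ^ (-n) :=
      (by fun_prop : Continuous fun r => y r 0).rpow_const fun r => Or.inl (hpos r).ne'
    have h2 : Continuous fun r => n / c / y r 0 :=
      continuous_const.div (by fun_prop) fun r => (hpos r).ne'
    have h3 : Continuous fun r => n * P r * S r / y r 0 :=
      (by fun_prop : Continuous fun r => n * P r * S r).div (by fun_prop) fun r => (hpos r).ne'
    fun_prop
  have hgd : ∀ r ∈ Ioo 0 R, HasDerivAt g (g' r) r := by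
    intro r hr
    have hr' := Ioo_subset_Icc_self hr
    have d0 : HasDerivAt (fun s => y s 0) (y r 1) r := by
      refine (((hasDerivAt_mul_weightedAvg 0 (g := fun s => y s 1) (by fun_prop) r).const_add
        1).congr_of_eventuallyEq ?_).congr_deriv (by simp)
      filter_upwards [hnhds r hr] with s hs using hy0 s hs
    have d1 : HasDerivAt (fun s => y s 1) (S r) r := by
      refine (hasDerivAt_mul_weightedAvg k hgc r).congr_of_eventuallyEq ?_
      filter_upwards [hnhds r hr] with s hs using hy1 s hs
    have d2 : HasDerivAt (fun s => y s 2) (y r 1 ^ 3 / (2 * y r 0 ^ 2)) r := by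
      have hc2 : Continuous fun s => y s 1 ^ 3 / (2 * y s 0 ^ 2) :=
        ((continuous_apply 2).comp hF : _)
      refine (((hasDerivAt_mul_weightedAvg 0 hc2 r).const_add
        0).congr_of_eventuallyEq ?_).congr_deriv (by simp)
      filter_upwards [hnhds r hr] with s hs using hy2 s hs
    refine (hasDerivAt_magmaField_one ((k + 1 : ℕ) : ℝ) c μ hn (hpos r) d0 d1 d2).congr_deriv ?_
    rw [hy1 r hr']
  let G : ℝ → ℝ := fun r => g 0 + ∫ s in (0:ℝ)..r, g' s
  have hG : ∀ r, HasDerivAt G (g' r) r := fun r => (hasDerivAt_primitive hg'c r).const_add _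
  have hGc : Continuous G := continuous_iff_continuousAt.2 fun r => (hG r).continuousAt
  have hGg : ∀ r ∈ Icc 0 R, G r = g r := by
    intro r hr
    have := intervalIntegral.integral_eq_sub_of_hasDerivAt_of_le hr.1 (f := g) (f' := g')
      hgc.continuousOn (fun s hs => hgd s ⟨hs.1, hs.2.trans_le hr.2⟩)
      (hg'c.intervalIntegrable _ _)
    simp only [G]
    linarith
  let V : ℝ → ℝ := weightedAvg k G
  let U : ℝ → ℝ := weightedAvg (k + 1) g'
  have hV : ∀ r, HasDerivAt V (U r) r := hasDerivAt_weightedAvg k hG hg'c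
  have hVc : Continuous V := continuous_weightedAvg k hGc
  have hUc : Continuous U := continuous_weightedAvg (k + 1) hg'c
  have hPd : ∀ r, HasDerivAt (fun r => r * V r) (G r - k * V r) r :=
    hasDerivAt_mul_weightedAvg k hGc
  have hSd : ∀ r, HasDerivAt (fun r => G r - k * V r) (g' r - k * U r) r := fun r =>
    (hG r).sub ((hV r).const_mul _)
  let Q : ℝ → ℝ := fun r => 1 + ∫ s in (0:ℝ)..r, s * V s
  have hQd : ∀ r, HasDerivAt Q (r * V r) r := fun r =>
    (hasDerivAt_primitive (g := fun s => s * V s) (by fun_prop) r).const_add _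
  have e1 : deriv Q = fun r => r * V r := funext fun r => (hQd r).deriv
  have e2 : deriv (deriv Q) = fun r => G r - k * V r := by
    rw [e1]; exact funext fun r => (hPd r).deriv
  have hPy : ∀ r ∈ Icc 0 R, r * V r = y r 1 := fun r hr => by
    rw [hy1 r hr]; simp only [V]; rw [weightedAvg_congr k hr hGg]
  have hQy : ∀ r ∈ Icc 0 R, Q r = y r 0 := by
    intro r hr
    have h1 := pow_mul_weightedAvg 0 (fun s => y s 1) r
    simp only [pow_zero, one_mul] at h1
    rw [hy0 r hr, h1]
    simp only [Q]
    congr 1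
    refine intervalIntegral.integral_congr fun s hs => ?_
    rw [uIcc_of_le hr.1] at hs
    exact hPy s ⟨hs.1, hs.2.trans hr.2⟩
  refine ⟨Q, contDiff_three_of_hasDerivAt hQd hPd hSd (by fun_prop), fun r hr => ?_,
    by simp [Q], by simp [e1], ?_, fun r hr => ⟨hQy r hr, by rw [e1]; exact hPy r hr⟩⟩
  · have hr' := Ioo_subset_Icc_self hr
    have hr0 : r ≠ 0 := hr.1.ne'
    rw [magmaODE_iff (s := G r - k * V r) (t := g' r - k * U r) hr0
      (by rw [hQy r hr']; exact hpos r) (hQd r).differentiableAt (by rw [e1]; exact hPd r)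
      (by rw [e2]; exact hSd r), e1, hQy r hr']
    have h1 : (k + 1) * V r = G r - r * U r := weightedAvg_eq_of_hasDerivAt k hG hg'c r
    have h2 : G r = (k + 1) * V r + r * U r := by linarith
    have h3 : S r = G r - k * V r := by
      simp only [hS, V]; rw [weightedAvg_congr k hr' hGg, hGg r hr']
    have h4 : P r = r * V r := by rw [hPy r hr', hy1 r hr']
    simp only [g', h3, h4]
    have h5 : ((k + 1 : ℕ) - 1 : ℝ) * ((G r - k * V r) / r - r * V r / r ^ 2) = k * U r := by
      rw [h2]; push_cast; field_simp; ring
    rw [h5]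
    ring
  · rw [e2]
    simp only [V, weightedAvg_zero]
    have h00 := (mem_Icc.2 ⟨le_rfl, hR.le⟩ : (0:ℝ) ∈ Icc 0 R)
    have z0 := hy0 0 h00
    have z1 := hy1 0 h00
    have z2 := hy2 0 h00
    simp only [zero_mul, add_zero] at z0 z1 z2
    have : G 0 = μ * (k + 1) := by
      rw [hGg 0 h00]
      simp [hg, magmaField, z0, z1, z2, F1]
    rw [this]
    field_simp
    ring

theorem isIVPSolutionOn.exists_isMagmaCurve {d : ℕ} (hd : 1 ≤ d) {n c μ σ R : ℝ} (hn : n ≠ 1)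
    (hμ : μ ≠ 0) (hR : 0 < R) (hRσ : R < σ) {Q : ℝ → ℝ} (hQ : isIVPSolutionOn d n c μ Q σ)
    (hpos : ∀ r ∈ Ioc 0 σ, 0 < Q r) :
    ∃ y : ℝ → Fin 3 → ℝ, Continuous y ∧ IsMagmaCurve d n c μ R y ∧
      (∀ r, 0 < y r 0) ∧ ∀ r ∈ Icc 0 R, y r 0 = Q r ∧ y r 1 = deriv Q r := by
  obtain ⟨k, rfl⟩ : ∃ k, d = k + 1 := ⟨d - 1, by omega⟩
  obtain ⟨hC, hode, hQ0, hQ1, hQ2⟩ := hQ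
  have hC3 : ContDiffOn ℝ (2 + 1) Q (Ioo 0 σ) := by
    have : (2 + 1 : WithTop ℕ∞) = 3 := by norm_num
    rw [this]; exact hC.mono Ioo_subset_Icc_self
  obtain ⟨hD1, -, hC2⟩ := (contDiffOn_succ_iff_deriv_of_isOpen isOpen_Ioo).1 hC3
  have hC2' : ContDiffOn ℝ (1 + 1) (deriv Q) (Ioo 0 σ) := by
    have : (1 + 1 : WithTop ℕ∞) = 2 := by norm_num
    rwa [this]
  obtain ⟨hD2, -, hC1⟩ := (contDiffOn_succ_iff_deriv_of_isOpen isOpen_Ioo).1 hC2'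
  have hD3 := hC1.differentiableOn one_ne_zero
  have hnhds : ∀ r ∈ Ioo 0 R, Ioo 0 σ ∈ 𝓝 r := fun r hr =>
    Ioo_mem_nhds hr.1 (hr.2.trans hRσ)
  have d1 : ∀ r ∈ Ioo 0 R, HasDerivAt Q (deriv Q r) r := fun r hr =>
    (hD1.differentiableAt (hnhds r hr)).hasDerivAt
  have d2 : ∀ r ∈ Ioo 0 R, HasDerivAt (deriv Q) (deriv (deriv Q) r) r := fun r hr =>
    (hD2.differentiableAt (hnhds r hr)).hasDerivAt
  have d3 : ∀ r ∈ Ioo 0 R, HasDerivAt (deriv (deriv Q)) (deriv (deriv (deriv Q)) r) r :=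
    fun r hr => (hD3.differentiableAt (hnhds r hr)).hasDerivAt
  have hP0 : HasDerivAt (deriv Q) μ 0 := by
    have : DifferentiableAt ℝ (deriv Q) 0 := by
      by_contra hcon
      exact hμ (hQ2 ▸ deriv_zero_of_not_differentiableAt hcon)
    exact hQ2 ▸ this.hasDerivAt
  have hQc : ContinuousOn Q (Icc 0 R) := hC.continuousOn.mono (Icc_subset_Icc_right hRσ.le)
  have hPc : ContinuousOn (deriv Q) (Icc 0 R) := by
    intro r hr
    rcases hr.1.eq_or_lt with rfl | hr0
    · exact hP0.continuousAt.continuousWithinAt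
    · exact (hD2.differentiableAt
        (Ioo_mem_nhds hr0 (hr.2.trans_lt hRσ))).continuousAt.continuousWithinAt
  let q : ℝ → ℝ := IccExtend hR.le ((Icc 0 R).domRestrict Q)
  let p : ℝ → ℝ := IccExtend hR.le ((Icc 0 R).domRestrict (deriv Q))
  have hqc : Continuous q := (continuousOn_iff_continuous_domRestrict.1 hQc).Icc_extend'
  have hpc : Continuous p := (continuousOn_iff_continuous_domRestrict.1 hPc).Icc_extend'
  have hqQ : ∀ r ∈ Icc 0 R, q r = Q r := fun r hr => IccExtend_of_mem hR.le _ hr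
  have hpQ : ∀ r ∈ Icc 0 R, p r = deriv Q r := fun r hr => IccExtend_of_mem hR.le _ hr
  have hQpos : ∀ r ∈ Icc 0 R, 0 < Q r := by
    intro r hr
    rcases hr.1.eq_or_lt with rfl | hr0
    · rw [hQ0]; exact one_pos
    · exact hpos r ⟨hr0, hr.2.trans hRσ.le⟩
  have hqpos : ∀ r, 0 < q r := fun r => hQpos _ (projIcc 0 R hR.le r).2
  have hw'c : Continuous fun r => p r ^ 3 / (2 * q r ^ 2) :=
    (by fun_prop : Continuous fun r => p r ^ 3).div (by fun_prop)
      fun r => mul_ne_zero two_ne_zero (pow_pos (hqpos r) 2).ne'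
  let w : ℝ → ℝ := fun r => ∫ s in (0:ℝ)..r, p s ^ 3 / (2 * q s ^ 2)
  have hwd : ∀ r, HasDerivAt w (p r ^ 3 / (2 * q r ^ 2)) r := hasDerivAt_primitive hw'c
  have hwc : Continuous w := continuous_iff_continuousAt.2 fun r => (hwd r).continuousAt
  let y : ℝ → Fin 3 → ℝ := fun r => ![q r, p r, w r]
  have hyc : Continuous y := by
    refine continuous_pi fun i => ?_
    fin_cases i
    exacts [hqc, hpc, hwc]
  have hF := continuous_magmaField ((k + 1 : ℕ) : ℝ) c μ hn hyc hqpos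
  let g : ℝ → ℝ := fun s => magmaField ((k + 1 : ℕ) : ℝ) n c μ (y s) 1
  have hgc : Continuous g := by fun_prop
  have hnI : ∀ r ∈ Ioo 0 R, Icc 0 R ∈ 𝓝 r := fun r hr => Icc_mem_nhds hr.1 hr.2
  have hqd : ∀ r ∈ Ioo 0 R, HasDerivAt q (p r) r := fun r hr => by
    rw [hpQ r (Ioo_subset_Icc_self hr)]
    refine (d1 r hr).congr_of_eventuallyEq ?_
    filter_upwards [hnI r hr] with s hs using hqQ s hs
  have hpd : ∀ r ∈ Ioo 0 R, HasDerivAt p (deriv (deriv Q) r) r := fun r hr => by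
    refine (d2 r hr).congr_of_eventuallyEq ?_
    filter_upwards [hnI r hr] with s hs using hpQ s hs
  let H : ℝ → ℝ := fun r => deriv (deriv Q) r + k * (deriv Q r / r) - g r
  have hH : ∀ r ∈ Ioo 0 R, HasDerivAt H 0 r := by
    intro r hr
    have hr0 : r ≠ 0 := hr.1.ne'
    have hr' := Ioo_subset_Icc_self hr
    have hg := hasDerivAt_magmaField_one ((k + 1 : ℕ) : ℝ) c μ hn (hqpos r) (hqd r hr)
      (hpd r hr) (hwd r)
    have hode' := (magmaODE_iff hr0 (hQpos r hr') (d1 r hr).differentiableAt (d2 r hr)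
      (d3 r hr)).1 (hode r ⟨hr.1, hr.2.trans hRσ⟩)
    refine (((d3 r hr).add (((d2 r hr).div (hasDerivAt_id r) hr0).const_mul
      (k : ℝ))).sub hg).congr_deriv ?_
    rw [hpQ r hr', hqQ r hr', ← hode']
    push_cast
    simp only [id]
    field_simp
    ring
  obtain ⟨K, hK⟩ := isOpen_Ioo.exists_is_const_of_deriv_eq_zero isPreconnected_Ioo
    (fun r hr => (hH r hr).differentiableAt.differentiableWithinAt)
    (fun r hr => (hH r hr).deriv)
  have hIoo : Ioo 0 R ∈ 𝓝[>] (0:ℝ) := Ioo_mem_nhdsGT hR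
  have h00 : (0:ℝ) ∈ Icc 0 R := ⟨le_rfl, hR.le⟩
  have hq0 : q 0 = 1 := by rw [hqQ 0 h00, hQ0]
  have hp0 : p 0 = 0 := by rw [hpQ 0 h00, hQ1]
  have hw0 : w 0 = 0 := by simp [w]
  have hg0 : g 0 = μ * (k + 1) := by
    simp [g, y, magmaField, hq0, hp0, hw0, F1]
  have hslope : Tendsto (fun r => deriv Q r / r) (𝓝[>] 0) (𝓝 μ) := by
    have h1 := (hasDerivAt_iff_tendsto_slope.1 hP0).mono_left
      (nhdsWithin_mono 0 (fun x hx => (ne_of_gt hx : x ≠ 0) : Ioi (0:ℝ) ⊆ {0}ᶜ))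
    refine h1.congr fun r => ?_
    simp [slope_def_field, hQ1]
  have hlim : Tendsto (deriv (deriv Q)) (𝓝[>] 0) (𝓝 (K - k * μ + μ * (k + 1))) := by
    have h1 := ((tendsto_const_nhds (x := K)).sub (hslope.const_mul (k : ℝ))).add
      ((hgc.tendsto 0).mono_left nhdsWithin_le_nhds)
    rw [hg0] at h1
    refine h1.congr' ?_
    filter_upwards [hIoo] with r hr
    have := hK r hr
    simp only [H] at this
    linarith
  have hK0 : K = 0 := by
    have h1 := hasDerivWithinAt_Ici_of_tendsto_deriv (s := Ioo 0 R) (f := deriv Q) (a := 0)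
      (fun r hr => (d2 r hr).differentiableAt.differentiableWithinAt)
      hP0.continuousAt.continuousWithinAt hIoo hlim
    have h2 := (uniqueDiffWithinAt_Ici (0:ℝ)).eq_deriv _ h1 hP0.hasDerivWithinAt
    linarith
  refine ⟨y, hyc, ?_, hqpos, fun r hr => ⟨hqQ r hr, hpQ r hr⟩⟩
  intro r hr i
  fin_cases i
  · have := eq_mul_weightedAvg_of_hasDerivAt 0 (p := fun r => q r - 1) (g := p) (R := R)
      (by fun_prop) hpc (by simp [hq0]) (fun s hs => by simpa using (hqd s hs).sub_const 1) r hr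
    exact sub_eq_iff_eq_add'.1 this
  · have := eq_mul_weightedAvg_of_hasDerivAt k (p := p) (g := g) (R := R) (by fun_prop) hgc hp0
      (fun s hs => by
        refine (hpd s hs).congr_deriv ?_
        have := hK s hs
        simp only [H] at this
        rw [hpQ s (Ioo_subset_Icc_self hs)]
        linarith) r hr
    exact this.trans (zero_add _).symm
  · have := eq_mul_weightedAvg_of_hasDerivAt 0 (p := w) (R := R) (by fun_prop) hw'c hw0
      (fun s hs => by simpa using hwd s) r hr
    exact this.trans (zero_add _).symm

theorem contDiffAt_magmaField (d n c μ : ℝ) {x : Fin 3 → ℝ} (hx : 0 < x 0) :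
    ContDiffAt ℝ 1 (magmaField d n c μ) x := by
  have hp : ∀ i, ContDiffAt ℝ 1 (fun x : Fin 3 → ℝ => x i) x := fun i => by fun_prop
  have h1 : (2 * x 0 : ℝ) ≠ 0 := mul_ne_zero two_ne_zero hx.ne'
  have h2 : (2 * x 0 ^ 2 : ℝ) ≠ 0 := mul_ne_zero two_ne_zero (pow_pos hx 2).ne'
  refine contDiffAt_pi.2 fun i => ?_
  fin_cases i
  · exact hp 1
  · have hF : ContDiffAt ℝ 1 (fun x : Fin 3 → ℝ => F1 d n c (x 0) μ) x :=
      ((contDiffAt_const.mul (((hp 0).rpow_const_of_ne hx.ne').sub contDiffAt_const)).sub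
        (contDiffAt_const.mul ((hp 0).log hx.ne'))).add contDiffAt_const
    exact (hF.sub ((contDiffAt_const.mul ((hp 1).pow 2)).div
      (contDiffAt_const.mul (hp 0)) h1)).sub (contDiffAt_const.mul (hp 2))
  · exact ((hp 1).pow 3).div (contDiffAt_const.mul ((hp 0).pow 2)) h2

theorem magmaField_eq_add (d n c μ μ' : ℝ) (x : Fin 3 → ℝ) :
    magmaField d n c μ' x = magmaField d n c μ x + ![0, (μ' - μ) * d, 0] := by
  funext i
  fin_cases i <;> simp [magmaField, F1]
  ring

/-- Coordinatewise projection to the box `[a, b]`. -/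
def boxClamp (a b x : Fin 3 → ℝ) : Fin 3 → ℝ := fun i => max (a i) (min (b i) (x i))

theorem boxClamp_mem {a b : Fin 3 → ℝ} (hab : a ≤ b) (x : Fin 3 → ℝ) :
    boxClamp a b x ∈ Icc a b :=
  ⟨fun _ => le_max_left _ _, fun i => max_le (hab i) (min_le_left _ _)⟩

theorem boxClamp_of_mem {a b x : Fin 3 → ℝ} (hx : x ∈ Icc a b) : boxClamp a b x = x := by
  funext i
  simp [boxClamp, hx.1 i, hx.2 i]

theorem lipschitzWith_boxClamp (a b : Fin 3 → ℝ) : LipschitzWith 1 (boxClamp a b) := by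
  refine LipschitzWith.of_dist_le_mul fun x y => ?_
  rw [NNReal.coe_one, one_mul, dist_pi_le_iff dist_nonneg]
  intro i
  refine le_trans ?_ (dist_le_pi_dist x y i)
  simp only [boxClamp, Real.dist_eq, max_comm (a i), min_comm (b i)]
  exact (abs_max_sub_max_le_abs _ _ _).trans (abs_min_sub_min_le_max _ _ _ _ |>.trans (by simp))

theorem exists_lipschitzWith_magmaField_boxClamp (d n c : ℝ) {a b : Fin 3 → ℝ} (hab : a ≤ b)
    (ha : 0 < a 0) :
    ∃ L, ∀ μ, LipschitzWith L fun x => magmaField d n c μ (boxClamp a b x) := by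
  have hU : IsOpen {x : Fin 3 → ℝ | 0 < x 0} :=
    isOpen_lt continuous_const (continuous_apply 0)
  have hsub : Icc a b ⊆ {x : Fin 3 → ℝ | 0 < x 0} := fun x hx => ha.trans_le (hx.1 0)
  have hC : ContDiffOn ℝ 1 (magmaField d n c 0) {x : Fin 3 → ℝ | 0 < x 0} := fun x hx =>
    (contDiffAt_magmaField d n c 0 hx).contDiffWithinAt
  obtain ⟨K, hK⟩ := (isCompact_Icc (a := a) (b := b)).exists_bound_of_continuousOn
    ((hC.continuousOn_fderiv_of_isOpen hU le_rfl).mono hsub)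
  have hL : LipschitzOnWith K.toNNReal (magmaField d n c 0) (Icc a b) :=
    (convex_Icc a b).lipschitzOnWith_of_nnnorm_fderiv_le
      (fun x hx => (contDiffAt_magmaField d n c 0 (hsub hx)).differentiableAt one_ne_zero)
      fun x hx => by
        rw [← NNReal.coe_le_coe, coe_nnnorm]
        exact (hK x hx).trans (Real.le_coe_toNNReal K)
  refine ⟨K.toNNReal, fun μ => LipschitzWith.of_dist_le_mul fun x y => ?_⟩
  rw [magmaField_eq_add d n c 0 μ, magmaField_eq_add d n c 0 μ (boxClamp a b y), dist_add_right]
  refine (hL.dist_le_mul _ (boxClamp_mem hab x) _ (boxClamp_mem hab y)).trans ?_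
  gcongr
  simpa using (lipschitzWith_boxClamp a b).dist_le_mul x y

theorem eventually_mul_abs_sub_lt (K : ℝ) {b : ℝ} (hb : 0 < b) (μ₀ : ℝ) :
    ∀ᶠ μ in 𝓝 μ₀, K * |μ - μ₀| < b := by
  have hc : Continuous fun μ => K * |μ - μ₀| := by fun_prop
  have h := hc.tendsto μ₀
  simp only [sub_self, abs_zero, mul_zero] at h
  exact h.eventually_lt_const hb

/-- Solutions of the integral equation depend continuously on the parameter `μ`. -/
theorem IsMagmaCurve.exists_near {d : ℕ} {n c μ₀ R : ℝ} (hn : n ≠ 1) (hR : 0 < R)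
    {y : ℝ → Fin 3 → ℝ} (hy : Continuous y) (hpos : ∀ r, 0 < y r 0)
    (h : IsMagmaCurve d n c μ₀ R y) {ε : ℝ} (hε : 0 < ε) :
    ∀ᶠ μ in 𝓝 μ₀, ∃ x : ℝ → Fin 3 → ℝ, Continuous x ∧ (∀ r, 0 < x r 0) ∧
      IsMagmaCurve d n c μ R x ∧ ∀ r ∈ Icc 0 R, |y r 0 - x r 0| < ε ∧
        |weightedAvg (d - 1) (fun s => magmaField d n c μ₀ (y s) 1) r -
          weightedAvg (d - 1) (fun s => magmaField d n c μ (x s) 1) r| < ε := by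
  obtain ⟨r₀, -, hr₀⟩ := isCompact_Icc.exists_isMinOn (nonempty_Icc.2 hR.le)
    (by fun_prop : Continuous fun r => y r 0).continuousOn
  obtain ⟨M, hM⟩ := (isCompact_Icc (a := 0) (b := R)).exists_bound_of_continuousOn hy.continuousOn
  set m := y r₀ 0 with hm
  have hm0 : 0 < m := hpos r₀
  have hmy : ∀ r ∈ Icc 0 R, m ≤ y r 0 := fun r hr => hr₀ hr
  have hMy : ∀ r ∈ Icc 0 R, ∀ i, |y r i| ≤ M := fun r hr i =>
    (norm_le_pi_norm (y r) i).trans (hM r hr)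
  have h00 : (0:ℝ) ∈ Icc 0 R := ⟨le_rfl, hR.le⟩
  have hmM : m ≤ M := (hmy 0 h00).trans ((le_abs_self _).trans (hMy 0 h00 0))
  let a : Fin 3 → ℝ := ![m / 2, -(M + 1), -(M + 1)]
  let b : Fin 3 → ℝ := fun _ => M + 1
  have hab : a ≤ b := by
    intro i
    fin_cases i <;> simp [a, b] <;> linarith
  have hbox : ∀ r ∈ Icc 0 R, ∀ x : Fin 3 → ℝ, (∀ i, |y r i - x i| < min (m / 2) 1) →
      x ∈ Icc a b := by
    intro r hr x hx
    have hx' : ∀ i, |y r i - x i| < m / 2 ∧ |y r i - x i| < 1 := fun i => lt_min_iff.1 (hx i)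
    have k1 := fun i => abs_lt.1 (hx' i).1
    have k2 := fun i => abs_lt.1 (hx' i).2
    have k3 := fun i => abs_le.1 (hMy r hr i)
    have k4 := hmy r hr
    refine ⟨fun i => ?_, fun i => ?_⟩
    · fin_cases i
      · change m / 2 ≤ x 0
        linarith [(k1 0).2]
      · change -(M + 1) ≤ x 1
        linarith [(k2 1).2, (k3 1).1]
      · change -(M + 1) ≤ x 2
        linarith [(k2 2).2, (k3 2).1]
    · change x i ≤ M + 1
      linarith [(k2 i).1, (k3 i).2]
  have hbox_pos : ∀ x ∈ Icc a b, 0 < x 0 := fun x hx => (half_pos hm0).trans_le (hx.1 0)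
  have hybox : ∀ r ∈ Icc 0 R, y r ∈ Icc a b := fun r hr => hbox r hr (y r) fun i => by
    simpa using hm0
  obtain ⟨L, hL⟩ := exists_lipschitzWith_magmaField_boxClamp d n c hab (half_pos hm0 : 0 < a 0)
  set C : ℝ := exp ((2 * L + 1) * R) * (2 * (R * d)) with hC
  have hC0 : 0 ≤ C := by positivity
  filter_upwards [eventually_mul_abs_sub_lt C (lt_min (half_pos hm0) one_pos) μ₀,
    eventually_mul_abs_sub_lt C hε μ₀, eventually_mul_abs_sub_lt (L * C + d) hε μ₀]
    with μ hμ1 hμ2 hμ3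
  have hyF := continuous_magmaField d c μ₀ hn hy hpos
  have hfy : ∀ i, Continuous fun s => magmaField d n c μ (boxClamp a b (y s)) i := fun i =>
    (continuous_apply i).comp ((hL μ).continuous.comp hy)
  have hdiff : ∀ x i, |magmaField d n c μ₀ x i - magmaField d n c μ x i| ≤ d * |μ - μ₀| := by
    intro x i
    rw [magmaField_eq_add d n c μ₀ μ x]
    have h0 : 0 ≤ d * |μ - μ₀| := by positivity
    fin_cases i
    · simpa using h0
    · simp [abs_mul, mul_comm]
    · simpa using h0
  obtain ⟨x, hxc, hx, hxy⟩ := exists_volterra_solution_near hR.le (magmaWeight d) magmaInit (hL μ)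
    hy (ε := R * d * |μ - μ₀|) (by positivity) (fun r hr i => by
      have h1 := abs_weightedAvg_sub_le (magmaWeight d i) (B := d * |μ - μ₀|)
        (by fun_prop : Continuous fun s => magmaField d n c μ₀ (y s) i) (hfy i) hr
        (fun s hs => by rw [boxClamp_of_mem (hybox s hs)]; exact hdiff _ _)
      rw [h r hr i, add_sub_add_left_eq_sub, ← mul_sub, abs_mul, abs_of_nonneg hr.1, mul_assoc]
      exact mul_le_mul hr.2 h1 (abs_nonneg _) hR.le)
  have hxy' : ∀ r ∈ Icc 0 R, ∀ i, |y r i - x r i| ≤ C * |μ - μ₀| := fun r hr i =>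
    (hxy r hr i).trans_eq (by rw [hC]; ring)
  have hxbox : ∀ r ∈ Icc 0 R, x r ∈ Icc a b := fun r hr =>
    hbox r hr (x r) fun i => (hxy' r hr i).trans_lt hμ1
  let X : ℝ → Fin 3 → ℝ := IccExtend hR.le ((Icc 0 R).domRestrict x)
  have hX : ∀ r ∈ Icc 0 R, X r = x r := fun r hr => IccExtend_of_mem hR.le _ hr
  have hXc : Continuous X :=
    (continuousOn_iff_continuous_domRestrict.1 hxc.continuousOn).Icc_extend'
  have hXpos : ∀ r, 0 < X r 0 := fun r => hbox_pos _ (hxbox _ (projIcc 0 R hR.le r).2)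
  have hXF := continuous_magmaField d c μ hn hXc hXpos
  refine ⟨X, hXc, hXpos, fun r hr i => ?_, fun r hr => ⟨?_, ?_⟩⟩
  · rw [hX r hr, hx r hr i]
    congr 2
    refine weightedAvg_congr _ hr fun s hs => ?_
    rw [boxClamp_of_mem (hxbox s hs), hX s hs]
  · rw [hX r hr]
    exact (hxy' r hr 0).trans_lt hμ2
  · refine (abs_weightedAvg_sub_le (B := (L * C + d) * |μ - μ₀|) _ (by fun_prop) (by fun_prop) hr
      fun s hs => ?_).trans_lt hμ3
    rw [hX s hs]
    have h1 := hdiff (y s) 1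
    have h2 : |magmaField d n c μ (y s) 1 - magmaField d n c μ (x s) 1| ≤
        L * (C * |μ - μ₀|) := by
      have h3 := (hL μ).dist_le_mul (y s) (x s)
      simp only [boxClamp_of_mem (hxbox s hs), boxClamp_of_mem (hybox s hs)] at h3
      rw [← Real.dist_eq]
      refine (dist_le_pi_dist _ _ 1).trans (h3.trans ?_)
      gcongr
      rw [dist_pi_le_iff (by positivity)]
      exact fun i => hxy' s hs i
    calc _ ≤ _ := abs_sub_le _ (magmaField d n c μ (y s) 1) _
      _ ≤ d * |μ - μ₀| + L * (C * |μ - μ₀|) := add_le_add h1 h2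
      _ = _ := by ring

/-- The shooting set A is open (Lemma "A is open"). -/
theorem magma_setA_open
    (d : ℕ) (hd : 1 ≤ d) (n c Qs : ℝ)
    (hn : n ∈ Icc (2:ℝ) 3) (hc : c ∈ Ico (1.55:ℝ) n)
    (hQs : Qs ∈ Ioo (0:ℝ) 1) (hQsz : h3ex (d:ℝ) n Qs = 0)
    (hQsu : ∀ q ∈ Ioo (0:ℝ) 1, h3ex (d:ℝ) n q = 0 → q = Qs) :
    IsOpen (setA (d:ℝ) n c Qs) := by
  have hn1 : n ≠ 1 := by
    have := hn.1
    intro h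
    linarith
  rw [isOpen_iff_mem_nhds]
  rintro μ₀ ⟨hμ₀, Q₀, σ, rs, hrs, hrsσ, hsol, hneg, hval⟩
  obtain ⟨R, hrsR, hRσ⟩ := exists_between hrsσ
  have hR : 0 < R := hrs.trans hrsR
  obtain ⟨y, hyc, hy, hypos, hyQ⟩ := hsol.exists_isMagmaCurve hd hn1 hμ₀.ne hR hRσ
    fun r hr => (hneg r hr).1
  have hRR : R ∈ Icc 0 R := ⟨hR.le, le_rfl⟩
  have hyR : y R 0 < Qs := by
    have hanti : StrictAntiOn Q₀ (Icc rs R) := by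
      refine strictAntiOn_of_deriv_neg (convex_Icc rs R)
        (hsol.1.continuousOn.mono (Icc_subset_Icc hrs.le hRσ.le)) fun r hr => ?_
      rw [interior_Icc] at hr
      exact (hneg r ⟨hrs.trans hr.1, (hr.2.trans hRσ).le⟩).2
    rw [(hyQ R hRR).1, ← hval]
    exact hanti (left_mem_Icc.2 hrsR.le) (right_mem_Icc.2 hrsR.le) hrsR
  have hyF := continuous_magmaField d c μ₀ hn1 hyc hypos
  set V := weightedAvg (d - 1) (fun s => magmaField d n c μ₀ (y s) 1) with hV
  have hVc : Continuous V := continuous_weightedAvg _ (by fun_prop)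
  have hVneg : ∀ r ∈ Icc 0 R, V r < 0 := by
    intro r hr
    rcases hr.1.eq_or_lt with rfl | hr0
    · have z : ∀ i, y 0 i = magmaInit i := fun i => by simpa using hy 0 hr i
      rw [hV, weightedAvg_zero]
      have : magmaField d n c μ₀ (y 0) 1 < 0 := by
        have hd0 : (0:ℝ) < d := by exact_mod_cast hd
        simpa [magmaField, z, magmaInit, F1] using mul_neg_of_neg_of_pos hμ₀ hd0
      exact div_neg_of_neg_of_pos this (by positivity)
    · have h1 : y r 1 = 0 + r * V r := hy r hr 1
      have h2 := (hneg r ⟨hr0, hr.2.trans hRσ.le⟩).2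
      rw [← (hyQ r hr).2, h1, zero_add] at h2
      exact neg_of_mul_neg_right h2 hr0.le
  obtain ⟨r₁, hr₁, hmax⟩ := isCompact_Icc.exists_isMaxOn (nonempty_Icc.2 hR.le) hVc.continuousOn
  have hη : 0 < min (-V r₁) (Qs - y R 0) :=
    lt_min (neg_pos.2 (hVneg r₁ hr₁)) (sub_pos.2 hyR)
  filter_upwards [hy.exists_near hn1 hR hyc hypos hη, eventually_lt_nhds hμ₀]
    with μ ⟨x, hxc, hxpos, hx, hxy⟩ hμ
  obtain ⟨Q, hQC, hode, hQ0, hQ1, hQ2, hQx⟩ := hx.exists_isIVPSolutionOn hd hn1 hR hxc hxpos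
  have hQR : Q R < Qs := by
    have h1 := (abs_lt.1 ((hxy R hRR).1.trans_le (min_le_right _ _))).1
    rw [(hQx R hRR).1]
    linarith
  obtain ⟨rs', hrs', hQrs'⟩ := intermediate_value_Ioo' hR.le hQC.continuous.continuousOn
    (⟨hQR, by rw [hQ0]; exact hQs.2⟩ : Qs ∈ Ioo (Q R) (Q 0))
  refine ⟨hμ, Q, R, rs', hrs'.1, hrs'.2, ⟨hQC.contDiffOn, hode, hQ0, hQ1, hQ2⟩,
    fun r hr => ?_, hQrs'⟩
  have hr' := Ioc_subset_Icc_self hr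
  obtain ⟨e0, e1⟩ := hQx r hr'
  refine ⟨e0 ▸ hxpos r, ?_⟩
  have h1 : x r 1 = 0 + r * weightedAvg (d - 1) (fun s => magmaField d n c μ (x s) 1) r :=
    hx r hr' 1
  rw [e1, h1, zero_add]
  refine mul_neg_of_pos_of_neg hr.1 ?_
  have h2 := (abs_lt.1 ((hxy r hr').2.trans_le (min_le_left _ _))).1
  have h3 : V r ≤ V r₁ := hmax hr'
  linarith
end
end
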